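/- arXiv:math/9406212 — 6 statements merged into one kernel-verified Lean document; each statement's English description precedes it below -/
import Mathlib

section
/- Let $u : \mathbb{R} \to \mathbb{R}$ be a nonincreasing function with $u(0) = 0$, and let $\nu_1$ be the probability measure on $\mathbb{R}$ with density $\tfrac12 e^{-|x|}$. Then there is a universal constant $K$ such that $\int_{(-\infty,0]} u^2\, d\nu_1 \le K \sum_{k \ge 1} \big(u(-k) - u(-k+1)\big)^2 e^{-k}$. -/
open MeasureTheory ENNReal

/-- The two-sided exponential probability measure on `ℝ`, of density `(1/2) e^{-|x|}`
with respect to Lebesgue measure. -/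
noncomputable def nuOne : Measure ℝ :=
  volume.withDensity fun x => ENNReal.ofReal (Real.exp (-|x|) / 2)

/-- Discrete Hardy-type inequality with geometric weights: if `b` contracts by `3/4` at each step
up to an error `3 * c n`, its partial sums are controlled by those of `c`. -/
lemma sum_succ_le_twelve_mul_sum {b c : ℕ → ℝ} (hb : ∀ n, 0 ≤ b n) (hb0 : b 0 = 0)
    (h : ∀ n, b (n + 1) ≤ 3 / 4 * b n + 3 * c n) (N : ℕ) :
    ∑ n ∈ Finset.range N, b (n + 1) ≤ 12 * ∑ n ∈ Finset.range N, c n := by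
  suffices ∑ n ∈ Finset.range N, b (n + 1) + 3 * b N ≤ 12 * ∑ n ∈ Finset.range N, c n by
    linarith [hb N]
  induction N with
  | zero => simp [hb0]
  | succ N ih =>
    rw [Finset.sum_range_succ, Finset.sum_range_succ]
    linarith [h N]

lemma ENNReal.tsum_ofReal_succ_le {b c : ℕ → ℝ} (hb : ∀ n, 0 ≤ b n) (hc : ∀ n, 0 ≤ c n)
    (hb0 : b 0 = 0) (h : ∀ n, b (n + 1) ≤ 3 / 4 * b n + 3 * c n) :
    ∑' n, ENNReal.ofReal (b (n + 1)) ≤ ENNReal.ofReal 12 * ∑' n, ENNReal.ofReal (c n) := by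
  refine ENNReal.tsum_le_of_sum_range_le fun N => ?_
  calc ∑ n ∈ Finset.range N, ENNReal.ofReal (b (n + 1))
      = ENNReal.ofReal (∑ n ∈ Finset.range N, b (n + 1)) :=
        (ENNReal.ofReal_sum_of_nonneg fun n _ => hb _).symm
    _ ≤ ENNReal.ofReal (12 * ∑ n ∈ Finset.range N, c n) :=
        ENNReal.ofReal_le_ofReal (sum_succ_le_twelve_mul_sum hb hb0 h N)
    _ = ENNReal.ofReal 12 * ∑ n ∈ Finset.range N, ENNReal.ofReal (c n) := by
        rw [ENNReal.ofReal_mul (by norm_num), ENNReal.ofReal_sum_of_nonneg fun n _ => hc n]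
    _ ≤ ENNReal.ofReal 12 * ∑' n, ENNReal.ofReal (c n) := by
        gcongr
        exact ENNReal.sum_le_tsum _

lemma Iic_zero_subset_iUnion_Ioc :
    Set.Iic (0 : ℝ) ⊆ ⋃ n : ℕ, Set.Ioc (-((n : ℝ) + 1)) (-(n : ℝ)) := by
  intro x hx
  have hx' : 0 ≤ -x := by simpa using hx
  exact Set.mem_iUnion.2 ⟨⌊-x⌋₊, by linarith [Nat.lt_floor_add_one (-x)],
    by linarith [Nat.floor_le hx']⟩

lemma exp_neg_one_le_half : Real.exp (-1) ≤ 1 / 2 := by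
  rw [Real.exp_neg, one_div]
  exact inv_anti₀ (by norm_num) (by linarith [Real.add_one_le_exp (1 : ℝ)])

lemma nuOne_Ioc_neg_le (n : ℕ) :
    nuOne (Set.Ioc (-((n : ℝ) + 1)) (-(n : ℝ))) ≤
      ENNReal.ofReal (2 * Real.exp (-((n : ℝ) + 1))) := by
  rw [nuOne, withDensity_apply _ measurableSet_Ioc]
  have hexp : Real.exp (-(n : ℝ)) = Real.exp (-((n : ℝ) + 1)) * Real.exp 1 := by
    rw [← Real.exp_add]
    ring_nf
  calc ∫⁻ x in Set.Ioc (-((n : ℝ) + 1)) (-(n : ℝ)), ENNReal.ofReal (Real.exp (-|x|) / 2)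
      ≤ ∫⁻ _ in Set.Ioc (-((n : ℝ) + 1)) (-(n : ℝ)),
          ENNReal.ofReal (2 * Real.exp (-((n : ℝ) + 1))) := by
        refine setLIntegral_mono' measurableSet_Ioc fun x hx => ENNReal.ofReal_le_ofReal ?_
        have hle : Real.exp (-|x|) ≤ Real.exp (-(n : ℝ)) :=
          Real.exp_le_exp.2 (by linarith [neg_le_abs x, hx.2])
        nlinarith [Real.exp_pos (-((n : ℝ) + 1)), Real.exp_one_lt_d9]
    _ = ENNReal.ofReal (2 * Real.exp (-((n : ℝ) + 1))) := by
        simp [Real.volume_Ioc]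

lemma setLIntegral_sq_Ioc_neg_le {u : ℝ → ℝ} (hu : Antitone u) (hu0 : u 0 = 0) (n : ℕ) :
    ∫⁻ x in Set.Ioc (-((n : ℝ) + 1)) (-(n : ℝ)), ENNReal.ofReal (u x ^ 2) ∂nuOne ≤
      ENNReal.ofReal 2 *
        ENNReal.ofReal (u (-((n : ℝ) + 1)) ^ 2 * Real.exp (-((n : ℝ) + 1))) := by
  calc ∫⁻ x in Set.Ioc (-((n : ℝ) + 1)) (-(n : ℝ)), ENNReal.ofReal (u x ^ 2) ∂nuOne
      ≤ ∫⁻ _ in Set.Ioc (-((n : ℝ) + 1)) (-(n : ℝ)),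
          ENNReal.ofReal (u (-((n : ℝ) + 1)) ^ 2) ∂nuOne := by
        refine setLIntegral_mono' measurableSet_Ioc fun x hx => ENNReal.ofReal_le_ofReal ?_
        have hx0 : x ≤ 0 := hx.2.trans (by simp)
        exact pow_le_pow_left₀ (hu0 ▸ hu hx0) (hu hx.1.le) 2
    _ = ENNReal.ofReal (u (-((n : ℝ) + 1)) ^ 2) *
          nuOne (Set.Ioc (-((n : ℝ) + 1)) (-(n : ℝ))) := setLIntegral_const _ _
    _ ≤ ENNReal.ofReal (u (-((n : ℝ) + 1)) ^ 2) *
          ENNReal.ofReal (2 * Real.exp (-((n : ℝ) + 1))) := by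
        gcongr
        exact nuOne_Ioc_neg_le n
    _ = _ := by
        rw [← ENNReal.ofReal_mul (by positivity), ← ENNReal.ofReal_mul (by norm_num)]
        ring_nf


/-- Lemma 2.7.8 of Talagrand: there is a universal constant `K` such that for every
nonincreasing `u : ℝ → ℝ` with `u(0) = 0`,
`∫_{(-∞,0]} u² dν₁ ≤ K ∑_{k ≥ 1} (u(-k) - u(-k+1))² e^{-k}`
(the sum over `k ≥ 1` is indexed below by `k = n + 1`, `n : ℕ`). -/
theorem talagrand_stmt9 :
    ∃ K : ℝ, 0 < K ∧
      ∀ u : ℝ → ℝ, Antitone u → u 0 = 0 →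
        ∫⁻ x in Set.Iic (0 : ℝ), ENNReal.ofReal (u x ^ 2) ∂nuOne ≤
          ENNReal.ofReal K *
            ∑' n : ℕ, ENNReal.ofReal
              ((u (-((n : ℝ) + 1)) - u (-(n : ℝ))) ^ 2 * Real.exp (-((n : ℝ) + 1))) := by
  refine ⟨24, by norm_num, fun u hu hu0 => ?_⟩
  have hstep : ∀ n : ℕ, u (-((n : ℝ) + 1)) ^ 2 * Real.exp (-((n : ℝ) + 1)) ≤
      3 / 4 * (u (-(n : ℝ)) ^ 2 * Real.exp (-(n : ℝ))) +
        3 * ((u (-((n : ℝ) + 1)) - u (-(n : ℝ))) ^ 2 * Real.exp (-((n : ℝ) + 1))) := by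
    intro n
    set a := u (-(n : ℝ))
    set a' := u (-((n : ℝ) + 1))
    have hsq : a' ^ 2 ≤ 3 / 2 * a ^ 2 + 3 * (a' - a) ^ 2 := by
      nlinarith [sq_nonneg (2 * a' - 3 * a)]
    have hexp : Real.exp (-((n : ℝ) + 1)) ≤ 1 / 2 * Real.exp (-(n : ℝ)) := by
      rw [neg_add, Real.exp_add]
      nlinarith [Real.exp_pos (-(n : ℝ)), exp_neg_one_le_half]
    linarith [mul_le_mul_of_nonneg_right hsq (Real.exp_nonneg (-((n : ℝ) + 1))),
      mul_le_mul_of_nonneg_left hexp (sq_nonneg a)]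
  have hsum := ENNReal.tsum_ofReal_succ_le
    (b := fun n : ℕ => u (-(n : ℝ)) ^ 2 * Real.exp (-(n : ℝ)))
    (c := fun n : ℕ => (u (-((n : ℝ) + 1)) - u (-(n : ℝ))) ^ 2 * Real.exp (-((n : ℝ) + 1)))
    (fun n => by positivity) (fun n => by positivity) (by simp [hu0])
    (fun n => by simpa using hstep n)
  simp only [Nat.cast_add, Nat.cast_one] at hsum
  calc ∫⁻ x in Set.Iic (0 : ℝ), ENNReal.ofReal (u x ^ 2) ∂nuOne
      ≤ ∫⁻ x in ⋃ n : ℕ, Set.Ioc (-((n : ℝ) + 1)) (-(n : ℝ)), ENNReal.ofReal (u x ^ 2) ∂nuOne :=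
        lintegral_mono_set Iic_zero_subset_iUnion_Ioc
    _ ≤ ∑' n : ℕ, ∫⁻ x in Set.Ioc (-((n : ℝ) + 1)) (-(n : ℝ)), ENNReal.ofReal (u x ^ 2) ∂nuOne :=
        lintegral_iUnion_le _ _
    _ ≤ ∑' n : ℕ, ENNReal.ofReal 2 *
          ENNReal.ofReal (u (-((n : ℝ) + 1)) ^ 2 * Real.exp (-((n : ℝ) + 1))) :=
        ENNReal.tsum_le_tsum fun n => setLIntegral_sq_Ioc_neg_le hu hu0 n
    _ ≤ ENNReal.ofReal 2 * (ENNReal.ofReal 12 * ∑' n : ℕ, ENNReal.ofReal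
          ((u (-((n : ℝ) + 1)) - u (-(n : ℝ))) ^ 2 * Real.exp (-((n : ℝ) + 1)))) := by
        rw [ENNReal.tsum_mul_left]
        gcongr
    _ = _ := by
        rw [← mul_assoc, ← ENNReal.ofReal_mul (by norm_num)]
        norm_num
end

section
/- Let $(\Omega,\Sigma,\mu)$ be a probability space and let $q \ge 2$ be an integer. For every measurable function $g$ on $\Omega$ with $\tfrac1q \le g \le 1$, one has $\Big(\int_\Omega \tfrac{1}{g}\, d\mu\Big)\Big(\int_\Omega g\, d\mu\Big)^q \le 1$. -/
open MeasureTheory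

theorem one_add_mul_one_sub_mul_pow_le_one (q : ℕ) {m : ℝ} (hm : 0 < m) :
    (1 + q * (1 - m)) * m ^ q ≤ 1 := by
  have bernoulli : 1 + (q : ℝ) * (m⁻¹ - 1) ≤ (1 + (m⁻¹ - 1)) ^ q :=
    one_add_mul_le_pow (by linarith [inv_pos.2 hm]) q
  have h_inv : 1 - m ≤ m⁻¹ - 1 := by
    have : m⁻¹ - 1 - (1 - m) = (1 - m) ^ 2 * m⁻¹ := by field_simp
    have : 0 ≤ (1 - m) ^ 2 * m⁻¹ := by positivity
    linarith
  calc (1 + q * (1 - m)) * m ^ q ≤ (1 + (m⁻¹ - 1)) ^ q * m ^ q := by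
        gcongr
        exact le_trans (by gcongr) bernoulli
    _ = 1 := by rw [add_sub_cancel, ← mul_pow, inv_mul_cancel₀ hm.ne', one_pow]

theorem inv_le_one_add_mul_one_sub {c x : ℝ} (hc : 0 < c) (hx : c⁻¹ ≤ x) (hx1 : x ≤ 1) :
    x⁻¹ ≤ 1 + c * (1 - x) := by
  have hx0 : 0 < x := (inv_pos.2 hc).trans_le hx
  have hcx : 1 ≤ c * x := (inv_le_iff_one_le_mul₀' hc).1 hx
  rw [inv_le_iff_one_le_mul₀ hx0]
  nlinarith [mul_nonneg (sub_nonneg.2 hcx) (sub_nonneg.2 hx1)]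

/-- Lemma 3.1.2 of Talagrand: for a probability space `(Ω, μ)`, an integer `q ≥ 2` and
a measurable `g` with `1/q ≤ g ≤ 1`, one has `(∫ (1/g) dμ) (∫ g dμ)^q ≤ 1`. -/
theorem talagrand_stmt10 {Ω : Type*} [MeasurableSpace Ω] (μ : Measure Ω)
    [IsProbabilityMeasure μ] (q : ℕ) (hq : 2 ≤ q)
    (g : Ω → ℝ) (hg : Measurable g)
    (hg1 : ∀ ω, ((q : ℝ))⁻¹ ≤ g ω) (hg2 : ∀ ω, g ω ≤ 1) :
    (∫ ω, (g ω)⁻¹ ∂μ) * (∫ ω, g ω ∂μ) ^ q ≤ 1 := by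
  have hq0 : (0 : ℝ) < q := by positivity
  have hg0 : ∀ ω, 0 < g ω := fun ω => (inv_pos.2 hq0).trans_le (hg1 ω)
  have hgi : Integrable g μ :=
    Integrable.of_bound hg.aestronglyMeasurable 1
      (ae_of_all _ fun ω => by rw [Real.norm_of_nonneg (hg0 ω).le]; exact hg2 ω)
  have hm : 0 < ∫ ω, g ω ∂μ := by
    have : ∫ _, (q : ℝ)⁻¹ ∂μ ≤ ∫ ω, g ω ∂μ := integral_mono (integrable_const _) hgi hg1
    rw [integral_const, probReal_univ, one_smul] at this
    exact (inv_pos.2 hq0).trans_le this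
  have hsub : Integrable (fun ω => 1 - g ω) μ := (integrable_const 1).sub hgi
  have h_inv : ∫ ω, (g ω)⁻¹ ∂μ ≤ 1 + q * (1 - ∫ ω, g ω ∂μ) :=
    calc ∫ ω, (g ω)⁻¹ ∂μ ≤ ∫ ω, (1 + q * (1 - g ω)) ∂μ :=
          integral_mono_of_nonneg (ae_of_all _ fun ω => inv_nonneg.2 (hg0 ω).le)
            ((integrable_const 1).add (hsub.const_mul _))
            (ae_of_all _ fun ω => inv_le_one_add_mul_one_sub hq0 (hg1 ω) (hg2 ω))
      _ = 1 + q * (1 - ∫ ω, g ω ∂μ) := by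
          rw [integral_add (integrable_const 1) (hsub.const_mul _), integral_const_mul,
            integral_sub (integrable_const 1) hgi]
          simp
  exact (mul_le_mul_of_nonneg_right h_inv (by positivity)).trans
    (one_add_mul_one_sub_mul_pow_le_one q hm)
end

section
/- Let $(\Omega,\Sigma,\mu)$ be a probability space, $N \ge 1$, $P = \mu^{\otimes N}$, and let $q \ge 2$ be an integer. For measurable subsets $A_1,\dots,A_q \subseteq \Omega^N$, all of positive probability, and $x \in \Omega^N$, set $f(A_1,\dots,A_q,x) = \inf\{k : \exists y^1 \in A_1, \dots, y^q \in A_q,\ \mathrm{card}\{i \le N : x_i \notin \{y^1_i,\dots,y^q_i\}\} \le k\}$. Then $\int^* q^{f(A_1,\dots,A_q,x)}\, dP(x) \le \frac{1}{\prod_{i \le q} P(A_i)}$. In particular, for a single measurable $A$ with $P(A)>0$ and any integer $k \ge 0$, $P^*(\{x : f(A,\dots,A,x) \ge k\}) \le \frac{1}{q^k P(A)^q}$. -/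
open MeasureTheory ENNReal

/-- The upper (outer) integral: infimum of `∫⁻ g` over measurable `g ≥ f`. -/
noncomputable def upperLintegral {α : Type*} [MeasurableSpace α] (μ : Measure α)
    (f : α → ℝ≥0∞) : ℝ≥0∞ :=
  ⨅ (g : α → ℝ≥0∞) (_ : Measurable g) (_ : ∀ x, f x ≤ g x), ∫⁻ x, g x ∂μ

/-- The product probability `μ^{⊗N}` on `Ω^N`. -/
noncomputable def piP {Ω : Type*} [MeasurableSpace Ω] (μ : Measure Ω) [SigmaFinite μ]
    (N : ℕ) : Measure (Fin N → Ω) :=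
  Measure.pi fun _ : Fin N => μ

/-- `f(A₁, …, A_q, x)`: the smallest `k` such that there exist `y¹ ∈ A₁, …, y^q ∈ A_q`
with `card {i ≤ N : x_i ∉ {y¹_i, …, y^q_i}} ≤ k`. -/
noncomputable def fqPoints {N : ℕ} {Ω : Type*} (q : ℕ) (A : Fin q → Set (Fin N → Ω))
    (x : Fin N → Ω) : ℕ :=
  sInf {k : ℕ | ∃ y : Fin q → Fin N → Ω, (∀ j, y j ∈ A j) ∧
    Nat.card {i : Fin N // ∀ j, x i ≠ y j i} ≤ k}

open Finset in
/-- The number of coordinates of `x` that are missed by all of the points `y j`. -/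
noncomputable def missCount {Ω ι : Type*} {N : ℕ} (x : Fin N → Ω) (y : ι → Fin N → Ω) : ℕ :=
  open Classical in #{i : Fin N | ∀ j, x i ≠ y j i}

lemma missCount_eq_natCard {Ω ι : Type*} {N : ℕ} (x : Fin N → Ω) (y : ι → Fin N → Ω) :
    missCount x y = Nat.card {i : Fin N // ∀ j, x i ≠ y j i} := by
  classical
  rw [missCount, Nat.card_eq_fintype_card, Fintype.card_subtype]

lemma missCount_cons_le {Ω ι : Type*} {N : ℕ} (z : Fin (N + 1) → Ω) (w : ι → Ω)
    (y : ι → Fin N → Ω) :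
    missCount z (fun j => Fin.cons (w j) (y j)) ≤ missCount (Fin.tail z) y + 1 := by
  classical
  simp only [missCount, Fin.card_filter_univ_succ, Fin.cons_succ, Fin.tail]
  split_ifs
  · exact le_of_eq (by congr!)
  · exact Nat.le_succ_of_le (le_of_eq (by congr!))

lemma missCount_cons_of_eq {Ω ι : Type*} {N : ℕ} (z : Fin (N + 1) → Ω) (w : ι → Ω)
    (y : ι → Fin N → Ω) (j : ι) (hj : w j = z 0) :
    missCount z (fun j => Fin.cons (w j) (y j)) = missCount (Fin.tail z) y := by
  classical
  simp only [missCount, Fin.card_filter_univ_succ, Fin.cons_succ, Fin.cons_zero, Fin.tail]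
  rw [if_neg fun h => h j hj.symm]
  congr!

/-- `a + q b ≤ q + 1` forces `a b ^ q ≤ 1`. -/
lemma mul_pow_le_one_of_add_mul_le {a b : ℝ} {q : ℕ} (hb : 0 ≤ b)
    (h : a + q * b ≤ q + 1) (hq : q ≠ 0) : a * b ^ q ≤ 1 := by
  rcases hb.eq_or_lt with rfl | hb
  · simp [hq]
  have bernoulli := one_add_mul_le_pow (a := b⁻¹ - 1) (by linarith [inv_pos.2 hb]) q
  have hinv : 1 - b ≤ b⁻¹ - 1 := by
    have : b⁻¹ - 1 - (1 - b) = (b - 1) ^ 2 / b := by field_simp; ring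
    linarith [div_nonneg (sq_nonneg (b - 1)) hb.le]
  have hq' : (q : ℝ) * (1 - b) ≤ q * (b⁻¹ - 1) := by gcongr
  have ha : a ≤ (b ^ q)⁻¹ := by
    rw [← inv_pow]
    rw [add_sub_cancel] at bernoulli
    linarith
  calc a * b ^ q ≤ (b ^ q)⁻¹ * b ^ q := by gcongr
    _ = 1 := inv_mul_cancel₀ (by positivity)

lemma ENNReal.mul_pow_le_one_of_add_mul_le {a b : ℝ≥0∞} {q : ℕ}
    (h : a + q * b ≤ q + 1) (hq : q ≠ 0) : a * b ^ q ≤ 1 := by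
  have htop : a + q * b ≠ ∞ := ne_top_of_le_ne_top (by finiteness) h
  have ha : a ≠ ∞ := (ENNReal.add_ne_top.1 htop).1
  have hb : b ≠ ∞ := by
    rintro rfl
    exact (ENNReal.add_ne_top.1 htop).2 (ENNReal.mul_top (by simpa using hq))
  lift a to NNReal using ha
  lift b to NNReal using hb
  norm_cast at h ⊢
  exact_mod_cast _root_.mul_pow_le_one_of_add_mul_le (a := a) b.2 (by exact_mod_cast h) hq

lemma ENNReal.inv_add_mul_le {g : ℝ≥0∞} {q : ℕ} (hq : q ≠ 0) (h₁ : (q : ℝ≥0∞)⁻¹ ≤ g)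
    (h₂ : g ≤ 1) : g⁻¹ + q * g ≤ q + 1 := by
  have hg : g ≠ ∞ := ne_top_of_le_ne_top (by simp) h₂
  lift g to NNReal using hg
  have hq0 : (q : NNReal) ≠ 0 := by simpa using hq
  have h₁' : (q : NNReal)⁻¹ ≤ g := by
    rw [← ENNReal.coe_natCast, ← ENNReal.coe_inv hq0] at h₁
    exact_mod_cast h₁
  have hgpos : 0 < g := lt_of_lt_of_le (by positivity) h₁'
  rw [← ENNReal.coe_inv hgpos.ne']
  norm_cast at h₂ ⊢
  have h1 : (1 : ℝ) ≤ q * g := by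
    have : (1 : NNReal) ≤ q * g := by
      rwa [inv_le_iff_one_le_mul₀' (by positivity)] at h₁'
    exact_mod_cast this
  have h2 : (g : ℝ) ≤ 1 := by exact_mod_cast h₂
  have hg' : (0 : ℝ) < g := by exact_mod_cast hgpos
  have key : (g : ℝ)⁻¹ + q * g ≤ q + 1 := by
    have : (q : ℝ) + 1 - ((g : ℝ)⁻¹ + q * g) = (1 - g) * (q * g - 1) / g := by
      field_simp; ring
    linarith [div_nonneg (mul_nonneg (sub_nonneg.2 h2) (sub_nonneg.2 h1)) hg'.le]
  exact_mod_cast key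

/-- A reverse Jensen inequality for functions with values in `[1/q, 1]`. -/
lemma lintegral_inv_mul_pow_le_one {Ω : Type*} [MeasurableSpace Ω] (μ : Measure Ω)
    [IsProbabilityMeasure μ] {q : ℕ} (hq : q ≠ 0) {g : Ω → ℝ≥0∞} (hg : Measurable g)
    (h₁ : ∀ᵐ ω ∂μ, (q : ℝ≥0∞)⁻¹ ≤ g ω) (h₂ : ∀ᵐ ω ∂μ, g ω ≤ 1) :
    (∫⁻ ω, (g ω)⁻¹ ∂μ) * (∫⁻ ω, g ω ∂μ) ^ q ≤ 1 := by
  refine ENNReal.mul_pow_le_one_of_add_mul_le ?_ hq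
  rw [← lintegral_const_mul _ hg, ← lintegral_add_right _ (hg.const_mul _)]
  calc ∫⁻ ω, (g ω)⁻¹ + q * g ω ∂μ ≤ ∫⁻ _, (q + 1 : ℝ≥0∞) ∂μ := by
        refine lintegral_mono_ae ?_
        filter_upwards [h₁, h₂] with ω a b using ENNReal.inv_add_mul_le hq a b
    _ = q + 1 := by simp

/-- The multi-function form of `lintegral_inv_mul_pow_le_one`. -/
lemma lintegral_min_iInf_inv_mul_prod_le_one {Ω : Type*} [MeasurableSpace Ω] (μ : Measure Ω)
    [IsProbabilityMeasure μ] {q : ℕ} (hq : q ≠ 0) {h : Fin q → Ω → ℝ≥0∞}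
    (hm : ∀ j, Measurable (h j)) (h₁ : ∀ j, ∀ᵐ ω ∂μ, h j ω ≤ 1) :
    (∫⁻ ω, (q : ℝ≥0∞) ⊓ ⨅ j, (h j ω)⁻¹ ∂μ) * ∏ j, ∫⁻ ω, h j ω ∂μ ≤ 1 := by
  let g : Ω → ℝ≥0∞ := fun ω => (q : ℝ≥0∞)⁻¹ ⊔ ⨆ j, h j ω
  have hg : Measurable g := measurable_const.sup (Measurable.iSup hm)
  have hinv : ∀ ω, (q : ℝ≥0∞) ⊓ ⨅ j, (h j ω)⁻¹ = (g ω)⁻¹ := fun ω => by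
    simp only [g]
    refine eq_of_forall_le_iff fun c => ?_
    rw [← ENNReal.inv_iSup, le_inf_iff, ENNReal.le_inv_iff_le_inv (b := _ ⊔ _), sup_le_iff,
      ENNReal.inv_le_inv, ENNReal.le_inv_iff_le_inv]
  simp_rw [hinv]
  calc (∫⁻ ω, (g ω)⁻¹ ∂μ) * ∏ j, ∫⁻ ω, h j ω ∂μ
      ≤ (∫⁻ ω, (g ω)⁻¹ ∂μ) * ∏ _j : Fin q, ∫⁻ ω, g ω ∂μ := by
        gcongr with j
        exact (le_iSup (fun j => h j _) j).trans le_sup_right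
    _ = (∫⁻ ω, (g ω)⁻¹ ∂μ) * (∫⁻ ω, g ω ∂μ) ^ q := by simp
    _ ≤ 1 := by
        refine lintegral_inv_mul_pow_le_one μ hq hg (ae_of_all _ fun ω => le_sup_left) ?_
        filter_upwards [ae_all_iff.2 h₁] with ω hω
        refine sup_le ?_ (iSup_le hω)
        rw [ENNReal.inv_le_one]
        exact_mod_cast Nat.one_le_iff_ne_zero.2 hq

/-- The one-coordinate step of Talagrand's induction, in terms of the measures `a j ω` of the
sections and `b j` of the projections. -/
lemma lintegral_le_inv_prod_of_sections {Ω : Type*} [MeasurableSpace Ω] (μ : Measure Ω)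
    [IsProbabilityMeasure μ] {q : ℕ} (hq : q ≠ 0) {a : Fin q → Ω → ℝ≥0∞} {b : Fin q → ℝ≥0∞}
    (hm : ∀ j, Measurable (a j)) (hab : ∀ j, ∀ᵐ ω ∂μ, a j ω ≤ b j)
    (hb0 : ∀ j, b j ≠ 0) (hb : ∀ j, b j ≠ ∞) {F : Ω → ℝ≥0∞}
    (hF : ∀ ω, F ω ≤ q * (∏ j, b j)⁻¹)
    (hFj : ∀ ω j, F ω ≤ (∏ i, if i = j then a i ω else b i)⁻¹) :
    ∫⁻ ω, F ω ∂μ ≤ (∏ j, ∫⁻ ω, a j ω ∂μ)⁻¹ := by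
  let p := ∏ j, b j
  have hp0 : p ≠ 0 := Finset.prod_ne_zero_iff.2 fun j _ => hb0 j
  have hp : p ≠ ∞ := ENNReal.prod_ne_top fun j _ => hb j
  let h : Fin q → Ω → ℝ≥0∞ := fun j ω => (b j)⁻¹ * a j ω
  have hprod : ∀ ω j, (∏ i, if i = j then a i ω else b i) = p * h j ω := fun ω j => by
    simp only [p, h]
    rw [← Finset.mul_prod_erase _ _ (Finset.mem_univ j),
      ← Finset.mul_prod_erase _ b (Finset.mem_univ j), if_pos rfl,
      Finset.prod_congr rfl fun i hi => if_neg (Finset.ne_of_mem_erase hi)]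
    calc _ = (b j * (b j)⁻¹) * (a j ω * ∏ i ∈ Finset.univ.erase j, b i) := by
          rw [ENNReal.mul_inv_cancel (hb0 j) (hb j), one_mul]
      _ = _ := by ring
  have hFle : ∀ ω, F ω ≤ p⁻¹ * ((q : ℝ≥0∞) ⊓ ⨅ j, (h j ω)⁻¹) := fun ω => by
    rw [mul_comm, ← div_eq_mul_inv, ENNReal.le_div_iff_mul_le (.inl hp0) (.inl hp)]
    refine le_inf ?_ (le_iInf fun j => ?_)
    · rw [← ENNReal.le_div_iff_mul_le (.inl hp0) (.inl hp), div_eq_mul_inv]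
      exact hF ω
    · rw [← ENNReal.le_div_iff_mul_le (.inl hp0) (.inl hp), div_eq_mul_inv, mul_comm,
        ← ENNReal.mul_inv (.inl hp0) (.inl hp), ← hprod]
      exact hFj ω j
  have key := lintegral_min_iInf_inv_mul_prod_le_one μ hq (h := h)
    (fun j => (hm j).const_mul _) (fun j => by
      filter_upwards [hab j] with ω hω
      calc (b j)⁻¹ * a j ω ≤ (b j)⁻¹ * b j := by gcongr
        _ = 1 := ENNReal.inv_mul_cancel (hb0 j) (hb j))
  have hint : ∏ j, ∫⁻ ω, h j ω ∂μ = p⁻¹ * ∏ j, ∫⁻ ω, a j ω ∂μ := by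
    simp only [h, p]
    rw [ENNReal.prod_inv_distrib fun i _ j _ _ => .inl (hb0 i), ← Finset.prod_mul_distrib]
    exact Finset.prod_congr rfl fun j _ => lintegral_const_mul _ (hm j)
  rw [hint, ← mul_assoc] at key
  calc ∫⁻ ω, F ω ∂μ ≤ ∫⁻ ω, p⁻¹ * ((q : ℝ≥0∞) ⊓ ⨅ j, (h j ω)⁻¹) ∂μ := lintegral_mono hFle
    _ = (∫⁻ ω, (q : ℝ≥0∞) ⊓ ⨅ j, (h j ω)⁻¹ ∂μ) * p⁻¹ := by
        rw [lintegral_const_mul' _ _ (ENNReal.inv_ne_top.2 hp0), mul_comm]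
    _ ≤ (∏ j, ∫⁻ ω, a j ω ∂μ)⁻¹ := ENNReal.le_inv_iff_mul_le.2 key

instance isProbabilityMeasure_piP {Ω : Type*} [MeasurableSpace Ω] (μ : Measure Ω)
    [IsProbabilityMeasure μ] (N : ℕ) : IsProbabilityMeasure (piP μ N) := by
  unfold piP; infer_instance

lemma lintegral_piP_succ {Ω : Type*} [MeasurableSpace Ω] (μ : Measure Ω)
    [IsProbabilityMeasure μ] (N : ℕ) {g : (Fin (N + 1) → Ω) → ℝ≥0∞} (hg : Measurable g) :
    ∫⁻ z, g z ∂piP μ (N + 1) = ∫⁻ ω, ∫⁻ x, g (Fin.cons ω x) ∂piP μ N ∂μ := by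
  have hmp := (measurePreserving_piFinSuccAbove (fun _ : Fin (N + 1) => μ) 0).symm
  have h := hmp.lintegral_comp hg
  rw [lintegral_prod (fun p => g _) (hg.comp hmp.measurable).aemeasurable] at h
  unfold piP
  rw [← h]
  simp [MeasurableEquiv.piFinSuccAbove, Fin.insertNthEquiv]

lemma measurable_fin_cons {Ω : Type*} [MeasurableSpace Ω] (N : ℕ) :
    Measurable fun p : Ω × (Fin N → Ω) => (Fin.cons p.1 p.2 : Fin (N + 1) → Ω) := by
  refine measurable_pi_lambda _ fun i => ?_
  induction i using Fin.cases with
  | zero => simpa using measurable_fst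
  | succ i => simpa using measurable_snd.eval

lemma piP_succ_apply {Ω : Type*} [MeasurableSpace Ω] (μ : Measure Ω)
    [IsProbabilityMeasure μ] (N : ℕ) {S : Set (Fin (N + 1) → Ω)} (hS : MeasurableSet S) :
    piP μ (N + 1) S = ∫⁻ ω, piP μ N {x | Fin.cons ω x ∈ S} ∂μ := by
  rw [← lintegral_indicator_one hS, lintegral_piP_succ μ N (measurable_one.indicator hS)]
  refine lintegral_congr fun ω => ?_
  have hω : MeasurableSet {x : Fin N → Ω | Fin.cons ω x ∈ S} :=
    ((measurable_fin_cons N).comp measurable_prodMk_left) hS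
  rw [← lintegral_indicator_one hω]
  rfl

universe u in
/-- Talagrand's inequality with a measurable parameter `t`: a jointly measurable majorant. -/
lemma exists_measurable_majorant {Ω : Type u} [MeasurableSpace Ω] (μ : Measure Ω)
    [IsProbabilityMeasure μ] {q : ℕ} (hq : q ≠ 0) (N : ℕ) :
    ∀ {T : Type u} [MeasurableSpace T] (A : Fin q → Set (T × (Fin N → Ω))),
      (∀ j, MeasurableSet (A j)) → ∃ g : T × (Fin N → Ω) → ℝ≥0∞, Measurable g ∧
        (∀ t x, g (t, x) ≠ ∞ → ∃ y : Fin q → Fin N → Ω,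
          (∀ j, (t, y j) ∈ A j) ∧ (q : ℝ≥0∞) ^ missCount x y ≤ g (t, x)) ∧
        ∀ t, ∫⁻ x, g (t, x) ∂piP μ N ≤ (∏ j, piP μ N {x | (t, x) ∈ A j})⁻¹ := by
  classical
  induction N with
  | zero =>
    intro T _ A hA
    refine ⟨fun p => if p ∈ ⋂ j, A j then 1 else ∞,
      Measurable.ite (.iInter hA) measurable_const measurable_const, ?_, ?_⟩
    · intro t x hx
      have hmem : (t, x) ∈ ⋂ j, A j := by
        by_contra h
        exact hx (if_neg h)
      exact ⟨fun _ => x, fun j => Set.mem_iInter.1 hmem j, by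
        beta_reduce
        rw [if_pos hmem]
        simp [missCount]⟩
    · intro t
      by_cases h : ∀ j, (t, (default : Fin 0 → Ω)) ∈ A j
      · have hmem : ∀ x : Fin 0 → Ω, (t, x) ∈ ⋂ j, A j := fun x => by
          rw [Subsingleton.elim x default]
          exact Set.mem_iInter.2 h
        simp only [if_pos (hmem _), lintegral_one, measure_univ, ENNReal.one_le_inv]
        exact Finset.prod_le_one' fun j _ => prob_le_one
      · push Not at h
        obtain ⟨j, hj⟩ := h
        rw [Finset.prod_eq_zero (Finset.mem_univ j), ENNReal.inv_zero]
        · exact le_top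
        · convert measure_empty (μ := piP μ 0)
          ext x
          rw [Subsingleton.elim x default]
          simpa using hj
  | succ N ih =>
    intro T _ A hA
    let A' : Fin q → Set ((T × Ω) × (Fin N → Ω)) :=
      fun j => {p | (p.1.1, (Fin.cons p.1.2 p.2 : Fin (N + 1) → Ω)) ∈ A j}
    have hA' : ∀ j, MeasurableSet (A' j) := fun j =>
      ((measurable_fst.comp measurable_fst).prodMk ((measurable_fin_cons N).comp
        ((measurable_snd.comp measurable_fst).prodMk measurable_snd))) (hA j)
    let B : Fin q → Set (T × (Fin N → Ω)) :=
      fun j => {p | μ {ω | ((p.1, ω), p.2) ∈ A' j} ≠ 0}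
    have hsec : ∀ j, MeasurableSet {r : (T × (Fin N → Ω)) × Ω | ((r.1.1, r.2), r.1.2) ∈ A' j} :=
      fun j => (((measurable_fst.comp measurable_fst).prodMk measurable_snd).prodMk
        (measurable_snd.comp measurable_fst)) (hA' j)
    have hB : ∀ j, MeasurableSet (B j) := fun j =>
      (measurable_measure_prodMk_left (ν := μ) (hsec j)) (measurableSet_singleton 0).compl
    have hBne : ∀ {j t x}, (t, x) ∈ B j → ∃ ω, ((t, ω), x) ∈ A' j := fun h =>
      nonempty_of_measure_ne_zero h
    let C : Fin q → Fin q → Set ((T × Ω) × (Fin N → Ω)) :=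
      fun j i => if i = j then A' i else {p | (p.1.1, p.2) ∈ B i}
    have hC : ∀ j i, MeasurableSet (C j i) := fun j i => by
      simp only [C]
      split_ifs
      · exact hA' i
      · exact ((measurable_fst.comp measurable_fst).prodMk measurable_snd) (hB i)
    obtain ⟨gB, hgB, hgB_le, hgB_int⟩ := ih B hB
    choose gC hgC hgC_le hgC_int using fun j => ih (C j) (hC j)
    have htail : Measurable fun p : T × (Fin (N + 1) → Ω) => Fin.tail p.2 :=
      measurable_pi_lambda _ fun i => (measurable_pi_apply i.succ).comp measurable_snd
    have hzero : Measurable fun p : T × (Fin (N + 1) → Ω) => p.2 0 :=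
      (measurable_pi_apply 0).comp measurable_snd
    let G : T × (Fin (N + 1) → Ω) → ℝ≥0∞ := fun p =>
      (q * gB (p.1, Fin.tail p.2)) ⊓ ⨅ j, gC j ((p.1, p.2 0), Fin.tail p.2)
    have hG : Measurable G :=
      ((hgB.comp (measurable_fst.prodMk htail)).const_mul _).inf
        (.iInf fun j => (hgC j).comp ((measurable_fst.prodMk hzero).prodMk htail))
    refine ⟨G, hG, ?_, ?_⟩
    · intro t z hz
      have : Nonempty (Fin q) := ⟨⟨0, Nat.pos_of_ne_zero hq⟩⟩
      obtain ⟨j, hj⟩ := exists_eq_ciInf_of_finite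
        (f := fun j => gC j ((t, z 0), Fin.tail z))
      rcases min_choice (q * gB (t, Fin.tail z)) (⨅ j, gC j ((t, z 0), Fin.tail z)) with h | h
      · have hGz : G (t, z) = q * gB (t, Fin.tail z) := h
        rw [hGz] at hz ⊢
        obtain ⟨y, hy, hle⟩ := hgB_le t (Fin.tail z) (by
          intro htop
          rw [htop, ENNReal.mul_top (by simpa using hq)] at hz
          exact hz rfl)
        choose w hw using fun j => hBne (hy j)
        refine ⟨fun j => Fin.cons (w j) (y j), hw, ?_⟩
        calc (q : ℝ≥0∞) ^ missCount z (fun j => Fin.cons (w j) (y j))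
            ≤ (q : ℝ≥0∞) ^ (missCount (Fin.tail z) y + 1) :=
              pow_le_pow_right₀ (by exact_mod_cast Nat.one_le_iff_ne_zero.2 hq)
                (missCount_cons_le z w y)
          _ = q * (q : ℝ≥0∞) ^ missCount (Fin.tail z) y := pow_succ' _ _
          _ ≤ q * gB (t, Fin.tail z) := by gcongr
      · have hGz : G (t, z) = gC j ((t, z 0), Fin.tail z) := h.trans hj.symm
        rw [hGz] at hz ⊢
        obtain ⟨y, hy, hle⟩ := hgC_le j (t, z 0) (Fin.tail z) hz
        have hex : ∀ i, ∃ ω, ((t, ω), y i) ∈ A' i ∧ (i = j → ω = z 0) := fun i => by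
          have hi := hy i
          simp only [C] at hi
          split_ifs at hi with hij
          · exact ⟨z 0, hi, fun _ => rfl⟩
          · obtain ⟨ω, hω⟩ := hBne hi
            exact ⟨ω, hω, fun h => absurd h hij⟩
        choose w hw hwj using hex
        refine ⟨fun j => Fin.cons (w j) (y j), hw, ?_⟩
        rwa [missCount_cons_of_eq z w y j (hwj j rfl)]
    · intro t
      let a : Fin q → Ω → ℝ≥0∞ := fun j ω => piP μ N {x | ((t, ω), x) ∈ A' j}
      let b : Fin q → ℝ≥0∞ := fun j => piP μ N {x | (t, x) ∈ B j}
      have ham : ∀ j, Measurable (a j) := fun j =>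
        (measurable_measure_prodMk_left (ν := piP μ N) (hA' j)).comp measurable_prodMk_left
      have haint : ∀ j, piP μ (N + 1) {z | (t, z) ∈ A j} = ∫⁻ ω, a j ω ∂μ := fun j =>
        piP_succ_apply μ N (measurable_prodMk_left (hA j))
      have hab : ∀ j, ∀ᵐ ω ∂μ, a j ω ≤ b j := fun j => by
        have hswap : ∀ᵐ x ∂piP μ N, ∀ᵐ ω ∂μ, ((t, ω), x) ∈ A' j → (t, x) ∈ B j := by
          refine ae_of_all _ fun x => ?_
          by_cases hx : (t, x) ∈ B j
          · exact ae_of_all _ fun _ _ => hx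
          · have hx0 : μ {ω | ((t, ω), x) ∈ A' j} = 0 := not_not.1 hx
            filter_upwards [measure_eq_zero_iff_ae_notMem.1 hx0] with ω hω h
            exact absurd h hω
        have hmeas : MeasurableSet {r : (Fin N → Ω) × Ω |
            ((t, r.2), r.1) ∈ A' j → (t, r.1) ∈ B j} :=
          MeasurableSet.imp
            (((measurable_const.prodMk measurable_snd).prodMk measurable_fst) (hA' j))
            ((measurable_const.prodMk measurable_fst) (hB j))
        rw [Measure.ae_ae_comm hmeas] at hswap
        filter_upwards [hswap] with ω hω
        exact measure_mono_ae hω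
      rw [lintegral_piP_succ μ N (g := fun z => G (t, z)) (hG.comp measurable_prodMk_left)]
      simp_rw [haint]
      by_cases h0 : ∃ j, ∫⁻ ω, a j ω ∂μ = 0
      · obtain ⟨j, hj⟩ := h0
        rw [Finset.prod_eq_zero (Finset.mem_univ j) hj, ENNReal.inv_zero]
        exact le_top
      push Not at h0
      refine lintegral_le_inv_prod_of_sections μ hq ham hab (fun j hbj => h0 j ?_)
        (fun j => measure_ne_top _ _) (fun ω => ?_) (fun ω j => ?_)
      · rw [lintegral_eq_zero_iff (ham j)]
        filter_upwards [hab j] with ω hω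
        exact le_antisymm (hω.trans hbj.le) zero_le
      · calc ∫⁻ x, G (t, Fin.cons ω x) ∂piP μ N ≤ ∫⁻ x, q * gB (t, x) ∂piP μ N :=
              lintegral_mono fun x => inf_le_left
          _ = q * ∫⁻ x, gB (t, x) ∂piP μ N :=
              lintegral_const_mul _ (hgB.comp measurable_prodMk_left)
          _ ≤ q * (∏ j, b j)⁻¹ := by gcongr; exact hgB_int t
      · calc ∫⁻ x, G (t, Fin.cons ω x) ∂piP μ N ≤ ∫⁻ x, gC j ((t, ω), x) ∂piP μ N :=
              lintegral_mono fun x => inf_le_right.trans (iInf_le _ j)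
          _ ≤ (∏ i, piP μ N {x | ((t, ω), x) ∈ C j i})⁻¹ := hgC_int j (t, ω)
          _ = (∏ i, if i = j then a i ω else b i)⁻¹ := by
              congr 1
              refine Finset.prod_congr rfl fun i _ => ?_
              simp only [C]
              split_ifs <;> rfl

lemma upperLintegral_pow_fqPoints_le {Ω : Type*} [MeasurableSpace Ω] (μ : Measure Ω)
    [IsProbabilityMeasure μ] (N : ℕ) {q : ℕ} (hq : q ≠ 0) (A : Fin q → Set (Fin N → Ω))
    (hA : ∀ j, MeasurableSet (A j)) :
    upperLintegral (piP μ N) (fun x => (q : ℝ≥0∞) ^ fqPoints q A x) ≤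
      (∏ j, piP μ N (A j))⁻¹ := by
  obtain ⟨g, hg, hle, hint⟩ := exists_measurable_majorant μ hq N (T := PUnit)
    (fun j => Prod.snd ⁻¹' A j) (fun j => measurable_snd (hA j))
  refine (iInf₂_le_of_le (fun x => g (PUnit.unit, x)) (hg.comp measurable_prodMk_left) <|
    iInf_le_of_le (fun x => ?_) le_rfl).trans (hint PUnit.unit)
  by_cases htop : g (PUnit.unit, x) = ∞
  · simp [htop]
  obtain ⟨y, hy, hyx⟩ := hle PUnit.unit x htop
  refine le_trans ?_ hyx
  exact pow_le_pow_right₀ (by exact_mod_cast Nat.one_le_iff_ne_zero.2 hq)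
    (Nat.sInf_le ⟨y, hy, (missCount_eq_natCard x y).ge⟩)

/-- Markov's inequality for the upper integral. -/
lemma mul_measure_le_upperLintegral {α : Type*} [MeasurableSpace α] (μ : Measure α)
    (f : α → ℝ≥0∞) (c : ℝ≥0∞) : c * μ {x | c ≤ f x} ≤ upperLintegral μ f := by
  refine le_iInf fun g => le_iInf fun hg => le_iInf fun hfg => ?_
  refine le_trans ?_ (mul_meas_ge_le_lintegral hg c)
  gcongr with x
  exact hfg x

/-- Theorem 3.1.1 of Talagrand: `∫* q^{f(A₁,…,A_q,x)} dP(x) ≤ 1/∏_{j ≤ q} P(A_j)`; in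
particular, for a single measurable `B` with `P(B) > 0` and any `k : ℕ`,
`P*(f(B,…,B,·) ≥ k) ≤ 1/(q^k P(B)^q)`. -/
theorem talagrand_stmt11 {Ω : Type*} [MeasurableSpace Ω] (μ : Measure Ω)
    [IsProbabilityMeasure μ] (N : ℕ) (hN : 1 ≤ N) (q : ℕ) (hq : 2 ≤ q)
    (A : Fin q → Set (Fin N → Ω)) (hA : ∀ j, MeasurableSet (A j))
    (hA0 : ∀ j, 0 < piP μ N (A j)) :
    upperLintegral (piP μ N) (fun x => (q : ℝ≥0∞) ^ fqPoints q A x) ≤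
        (∏ j, piP μ N (A j))⁻¹ ∧
      ∀ B : Set (Fin N → Ω), MeasurableSet B → 0 < piP μ N B → ∀ k : ℕ,
        piP μ N {x | k ≤ fqPoints q (fun _ => B) x} ≤
          ((q : ℝ≥0∞) ^ k * piP μ N B ^ q)⁻¹ := by
  have hq0 : q ≠ 0 := by lia
  refine ⟨upperLintegral_pow_fqPoints_le μ N hq0 A hA, fun B hB _ k => ?_⟩
  rw [ENNReal.le_inv_iff_mul_le]
  have hsub : {x | k ≤ fqPoints q (fun _ => B) x} ⊆
      {x | (q : ℝ≥0∞) ^ k ≤ (q : ℝ≥0∞) ^ fqPoints q (fun _ => B) x} := fun x hx =>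
    pow_le_pow_right₀ (a := (q : ℝ≥0∞)) (by exact_mod_cast Nat.one_le_iff_ne_zero.2 hq0) hx
  have hint := upperLintegral_pow_fqPoints_le μ N hq0 (fun _ => B) (fun _ => hB)
  rw [Finset.prod_const, Finset.card_univ, Fintype.card_fin] at hint
  have hmarkov := (mul_measure_le_upperLintegral (piP μ N)
    (fun x => (q : ℝ≥0∞) ^ fqPoints q (fun _ => B) x) ((q : ℝ≥0∞) ^ k)).trans hint
  rw [ENNReal.le_inv_iff_mul_le] at hmarkov
  calc piP μ N {x | k ≤ fqPoints q (fun _ => B) x} * ((q : ℝ≥0∞) ^ k * piP μ N B ^ q)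
      ≤ piP μ N {x | (q : ℝ≥0∞) ^ k ≤ (q : ℝ≥0∞) ^ fqPoints q (fun _ => B) x} *
          ((q : ℝ≥0∞) ^ k * piP μ N B ^ q) := by gcongr
    _ = _ := by ring
    _ ≤ 1 := hmarkov
end

section
/- For every real $r$ with $0 < r \le 1$, $\inf_{0 \le \lambda \le 1} r^{-\lambda} e^{(1-\lambda)^2/4} \le 2 - r$; and for $r = 0$ (with $r^0 = 1$) the value at $\lambda = 0$ gives $e^{1/4} \le 2$. -/
theorem exp_le_cubic {u : ℝ} (h0 : 0 ≤ u) (h1 : u ≤ 1) :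
    Real.exp u ≤ 1 + u + u ^ 2 / 2 + 2 / 9 * u ^ 3 := by
  have h := Real.exp_bound' h0 h1 (n := 3) (by norm_num)
  norm_num [Finset.sum_range_succ, Nat.factorial] at h
  linarith

theorem exp_neg_le_cubic {t : ℝ} (h0 : 0 ≤ t) (h1 : t ≤ 1) :
    Real.exp (-t) ≤ 1 - t + t ^ 2 / 2 + 2 / 9 * t ^ 3 := by
  have h := Real.exp_bound (x := -t) (by rwa [abs_neg, abs_of_nonneg h0]) (n := 3) (by norm_num)
  rw [abs_neg, abs_of_nonneg h0] at h
  have h' := (abs_le.mp h).2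
  norm_num [Finset.sum_range_succ, Nat.factorial] at h'
  linarith

theorem exp_sub_sq_le_two_sub_exp_neg {t : ℝ} (h0 : 0 ≤ t) (h1 : t ≤ 1 / 2) :
    Real.exp (t - t ^ 2) ≤ 2 - Real.exp (-t) := by
  have hu : 0 ≤ t - t ^ 2 := by nlinarith
  have hut : t - t ^ 2 ≤ t := by nlinarith
  have hexp := exp_le_cubic hu (by linarith)
  have hneg := exp_neg_le_cubic h0 (by linarith)
  have hcube : (t - t ^ 2) ^ 3 ≤ t ^ 3 := pow_le_pow_left₀ hu hut 3
  have ht3 : 0 ≤ t ^ 3 := by positivity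
  nlinarith [mul_le_mul_of_nonneg_left h1 ht3]

theorem exp_quarter_le_two_sub_exp_neg {t : ℝ} (h : 1 / 2 ≤ t) :
    Real.exp (1 / 4) ≤ 2 - Real.exp (-t) := by
  have hhalf := exp_sub_sq_le_two_sub_exp_neg (t := 1 / 2) (by norm_num) le_rfl
  rw [show (1 / 2 : ℝ) - (1 / 2) ^ 2 = 1 / 4 by norm_num] at hhalf
  have hmono : Real.exp (-t) ≤ Real.exp (-(1 / 2)) := Real.exp_le_exp.mpr (by linarith)
  linarith

/-- Lemma 4.1.3 of Talagrand: for `0 < r ≤ 1`,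
`inf_{0 ≤ λ ≤ 1} r^{-λ} exp((1-λ)²/4) ≤ 2 - r`; for `r = 0` the claim reduces to
`e^{1/4} ≤ 2` (the value at `λ = 0`). -/
theorem talagrand_stmt12 :
    (∀ r : ℝ, 0 < r → r ≤ 1 →
      (⨅ l : Set.Icc (0 : ℝ) 1, r ^ (-(l : ℝ)) * Real.exp ((1 - (l : ℝ)) ^ 2 / 4)) ≤
        2 - r) ∧
    Real.exp (1 / 4) ≤ 2 := by
  refine ⟨fun r hr hr1 => ?_, ?_⟩
  · have hbdd : BddBelow (Set.range fun l : Set.Icc (0 : ℝ) 1 =>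
        r ^ (-(l : ℝ)) * Real.exp ((1 - (l : ℝ)) ^ 2 / 4)) := by
      refine ⟨0, ?_⟩
      rintro _ ⟨l, rfl⟩
      positivity
    obtain ⟨t, rfl⟩ : ∃ t, r = Real.exp (-t) := ⟨-Real.log r, by rw [neg_neg, Real.exp_log hr]⟩
    have ht : 0 ≤ t := by simpa using hr1
    rcases le_total t (1 / 2) with h | h
    · refine (ciInf_le hbdd ⟨1 - 2 * t, by linarith, by linarith⟩).trans ?_
      refine le_of_eq_of_le ?_ (exp_sub_sq_le_two_sub_exp_neg ht h)
      rw [← Real.exp_mul, ← Real.exp_add]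
      ring_nf
    · refine (ciInf_le hbdd ⟨0, by norm_num, by norm_num⟩).trans ?_
      simpa using exp_quarter_le_two_sub_exp_neg h
  · have h := exp_quarter_le_two_sub_exp_neg (le_refl (1 / 2 : ℝ))
    linarith [Real.exp_pos (-(1 / 2 : ℝ))]
end

section
/- For $\alpha > 0$ and $0 \le u \le 1$ define $\xi(\alpha,u) = \alpha(1-u)\log(1-u) - (\alpha + 1 - \alpha u)\log\Big(\frac{1+\alpha-\alpha u}{1+\alpha}\Big)$ (with $0 \log 0 = 0$). Then for every $r$ with $0 < r < 1$: $\inf_{0 \le \lambda \le 1} r^{-\lambda \alpha} \exp \xi(\alpha, 1-\lambda) = 1 + \alpha - \alpha r$. -/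
/-- `ξ(α,u) = α(1-u)log(1-u) - (α+1-αu) log((1+α-αu)/(1+α))`; the convention
`0 log 0 = 0` is automatic since `Real.log 0 = 0` in Mathlib. -/
noncomputable def xiTal (α u : ℝ) : ℝ :=
  α * (1 - u) * Real.log (1 - u) -
    (α + 1 - α * u) * Real.log ((1 + α - α * u) / (1 + α))

/-- The Talagrand objective written as a single exponential. -/
lemma rpow_mul_exp_xiTal {α r l : ℝ} (hα : 0 < α) (hr : 0 < r) (hl : 0 ≤ l) :
    r ^ (-(l * α)) * Real.exp (xiTal α (1 - l)) =
      Real.exp (α * l * (Real.log l - Real.log r) -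
        (1 + α * l) * (Real.log (1 + α * l) - Real.log (1 + α))) := by
  have h : (1 + α - α * (1 - l)) = 1 + α * l := by ring
  rw [Real.rpow_def_of_pos hr, ← Real.exp_add, xiTal, h,
    Real.log_div (by positivity) (by positivity), sub_sub_cancel]
  congr 1
  ring

/-- Concavity of the logarithm, as `log x ≤ x - 1` at two points. -/
lemma log_le_xiTal_exponent {α r l : ℝ} (hα : 0 < α) (hr0 : 0 < r) (hr1 : r < 1) (hl : 0 ≤ l) :
    Real.log (1 + α - α * r) ≤ α * l * (Real.log l - Real.log r) -
      (1 + α * l) * (Real.log (1 + α * l) - Real.log (1 + α)) := by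
  have hM : 0 < 1 + α - α * r := by nlinarith
  have hs : 0 < 1 + α * l := by positivity
  have ha : 0 < 1 + α := by positivity
  have h1 : Real.log (1 + α - α * r) + Real.log (1 + α * l) - Real.log (1 + α) ≤
      (1 + α - α * r) * (1 + α * l) / (1 + α) - 1 := by
    rw [← Real.log_mul hM.ne' hs.ne', ← Real.log_div (by positivity) ha.ne']
    exact Real.log_le_sub_one_of_pos (by positivity)
  have h2 : α * l * (Real.log r + Real.log (1 + α * l) - Real.log l - Real.log (1 + α)) ≤
      α * r * (1 + α * l) / (1 + α) - α * l := by
    rcases hl.eq_or_lt with rfl | hl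
    · simp only [mul_zero, zero_mul, sub_zero]
      positivity
    · have h := Real.log_le_sub_one_of_pos (x := r * (1 + α * l) / l / (1 + α)) (by positivity)
      rw [Real.log_div (by positivity) ha.ne', Real.log_div (by positivity) hl.ne',
        Real.log_mul hr0.ne' hs.ne'] at h
      refine (mul_le_mul_of_nonneg_left h (by positivity)).trans_eq ?_
      field_simp
  have h3 : (1 + α - α * r) * (1 + α * l) / (1 + α) + α * r * (1 + α * l) / (1 + α) =
      1 + α * l := by
    field_simp
    ring
  linarith

/-- The exponent at the minimiser `l = r / (1 + α - α * r)`. -/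
lemma xiTal_exponent_minimiser {α r : ℝ} (hα : 0 < α) (hr0 : 0 < r) (hM : 0 < 1 + α - α * r) :
    α * (r / (1 + α - α * r)) * (Real.log (r / (1 + α - α * r)) - Real.log r) -
      (1 + α * (r / (1 + α - α * r))) *
        (Real.log (1 + α * (r / (1 + α - α * r))) - Real.log (1 + α)) =
      Real.log (1 + α - α * r) := by
  have h : 1 + α * (r / (1 + α - α * r)) = (1 + α) / (1 + α - α * r) := by
    field_simp
    ring
  have hlog : Real.log (1 + α * (r / (1 + α - α * r))) =
      Real.log (1 + α) - Real.log (1 + α - α * r) := by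
    rw [h, Real.log_div (by positivity) hM.ne']
  rw [hlog, Real.log_div hr0.ne' hM.ne']
  ring

/-- Lemma 4.2.1 of Talagrand: for `α > 0` and `0 < r < 1`,
`inf_{0 ≤ λ ≤ 1} r^{-λα} exp ξ(α, 1-λ) = 1 + α - αr`. -/
theorem talagrand_stmt14 (α r : ℝ) (hα : 0 < α) (hr0 : 0 < r) (hr1 : r < 1) :
    (⨅ l : Set.Icc (0 : ℝ) 1,
        r ^ (-((l : ℝ) * α)) * Real.exp (xiTal α (1 - (l : ℝ)))) =
      1 + α - α * r := by
  have hM : 0 < 1 + α - α * r := by nlinarith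
  have hl₀ : r / (1 + α - α * r) ∈ Set.Icc (0 : ℝ) 1 :=
    ⟨by positivity, (div_le_one hM).2 (by nlinarith)⟩
  refine IsLeast.csInf_eq ⟨⟨⟨_, hl₀⟩, ?_⟩, ?_⟩
  · simp only
    rw [rpow_mul_exp_xiTal hα hr0 hl₀.1, xiTal_exponent_minimiser hα hr0 hM, Real.exp_log hM]
  · rintro _ ⟨l, rfl⟩
    simp only
    rw [rpow_mul_exp_xiTal hα hr0 l.2.1, ← Real.log_le_iff_le_exp hM]
    exact log_le_xiTal_exponent hα hr0 hr1 l.2.1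
end

section
/- Let $\Omega = \{0,1\}$ with the uniform probability $\mu$ ($\mu(\{0\}) = \mu(\{1\}) = 1/2$), $N \ge 1$, and $P = \mu^{\otimes N}$ on $\Omega^N$. For $A \subseteq \Omega^N$ with $P(A) > 0$ and $x \in \Omega^N$ let $f_c(A,x)$ be the Euclidean distance from $0$ to the convex hull of $U_A(x) = \{s \in \{0,1\}^N : \exists y \in A,\ s_i = 0 \Rightarrow x_i = y_i\}$ in $\mathbb{R}^N$. Then for every $\alpha \ge 1$: $\int \exp\Big(\frac{\alpha}{\alpha+1} f_c(A,x)^2\Big)\, dP(x) \le \frac{1}{P(A)^{\alpha}}$. -/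
open MeasureTheory ENNReal

/-- `U_A(x) = {s ∈ {0,1}^N : ∃ y ∈ A, s_i = 0 → x_i = y_i}`, viewed inside
Euclidean space `ℝ^N`. -/
def convUA {N : ℕ} {Ω : Type*} (A : Set (Fin N → Ω)) (x : Fin N → Ω) :
    Set (EuclideanSpace ℝ (Fin N)) :=
  {s | (∀ i, s i = 0 ∨ s i = 1) ∧ ∃ y ∈ A, ∀ i, s i = 0 → x i = y i}

/-- `f_c(A,x)`: the Euclidean distance from `0` to the convex hull of `U_A(x)`. -/
noncomputable def fConv {N : ℕ} {Ω : Type*} (A : Set (Fin N → Ω)) (x : Fin N → Ω) : ℝ :=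
  Metric.infDist (0 : EuclideanSpace ℝ (Fin N)) (convexHull ℝ (convUA A x))

/-- The section of `A` over the first coordinate `ω`. -/
def headSection {N : ℕ} {Ω : Type*} (A : Set (Fin (N + 1) → Ω)) (ω : Ω) : Set (Fin N → Ω) :=
  {y | (Fin.cons ω y : Fin (N + 1) → Ω) ∈ A}

/-- Prepending a coordinate, as an affine map in the tail. -/
def consAffine {N : ℕ} (c : ℝ) :
    EuclideanSpace ℝ (Fin N) →ᵃ[ℝ] EuclideanSpace ℝ (Fin (N + 1)) where
  toFun p := WithLp.toLp 2 (Fin.cons c p.ofLp)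
  linear :=
    { toFun := fun p => WithLp.toLp 2 (Fin.cons 0 p.ofLp)
      map_add' := fun p q => by
        ext i; refine Fin.cases ?_ (fun j => ?_) i <;> simp
      map_smul' := fun a p => by
        ext i; refine Fin.cases ?_ (fun j => ?_) i <;> simp }
  map_vadd' p v := by
    ext i; refine Fin.cases ?_ (fun j => ?_) i <;> simp

@[simp]
lemma consAffine_zero {N : ℕ} (c : ℝ) (p : EuclideanSpace ℝ (Fin N)) : consAffine c p 0 = c := rfl

@[simp]
lemma consAffine_succ {N : ℕ} (c : ℝ) (p : EuclideanSpace ℝ (Fin N)) (i : Fin N) :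
    consAffine c p i.succ = p i := rfl

lemma consAffine_mem_convexHull {N : ℕ} {Ω : Type*} {A : Set (Fin (N + 1) → Ω)} {ω ω' : Ω}
    {x : Fin N → Ω} {c : ℝ} (hc : c = 0 ∧ ω = ω' ∨ c = 1) {p : EuclideanSpace ℝ (Fin N)}
    (hp : p ∈ convexHull ℝ (convUA (headSection A ω') x)) :
    consAffine c p ∈ convexHull ℝ (convUA A (Fin.cons ω x)) := by
  have hsub : consAffine c '' convUA (headSection A ω') x ⊆ convUA A (Fin.cons ω x) := by
    rintro _ ⟨s, ⟨hs, y, hy, hxy⟩, rfl⟩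
    refine ⟨fun i => ?_, Fin.cons ω' y, hy, fun i => ?_⟩
    · refine Fin.cases ?_ (fun j => ?_) i
      · rcases hc with ⟨h, -⟩ | h <;> simp [h]
      · simpa using hs j
    · refine Fin.cases ?_ (fun j => ?_) i
      · rcases hc with ⟨-, h⟩ | h <;> simp [h]
      · simpa using hxy j
  refine convexHull_mono hsub ?_
  rw [← AffineMap.image_convexHull]
  exact ⟨p, hp, rfl⟩

lemma finite_convUA {N : ℕ} {Ω : Type*} (A : Set (Fin N → Ω)) (x : Fin N → Ω) :
    (convUA A x).Finite := by
  refine (Set.finite_range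
    fun b : Fin N → Bool => (WithLp.toLp 2 fun i => if b i then (1 : ℝ) else 0)).subset ?_
  rintro s ⟨hs, -⟩
  refine ⟨fun i => decide (s i = 1), ?_⟩
  ext i
  rcases hs i with h | h <;> simp [h]

lemma convUA_nonempty {N : ℕ} {Ω : Type*} {A : Set (Fin N → Ω)} (hA : A.Nonempty)
    (x : Fin N → Ω) : (convUA A x).Nonempty := by
  obtain ⟨y, hy⟩ := hA
  exact ⟨WithLp.toLp 2 fun _ => 1, by simp, y, hy, by simp⟩

lemma exists_norm_eq_fConv {N : ℕ} {Ω : Type*} {A : Set (Fin N → Ω)} (hA : A.Nonempty)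
    (x : Fin N → Ω) : ∃ p ∈ convexHull ℝ (convUA A x), ‖p‖ = fConv A x := by
  obtain ⟨p, hp, h⟩ := ((finite_convUA A x).isCompact_convexHull ℝ).exists_infDist_eq_dist
    (convUA_nonempty hA x).convexHull 0
  exact ⟨p, hp, by rw [fConv, h, dist_zero_left]⟩

lemma fConv_sq_le {N : ℕ} {Ω : Type*} {A : Set (Fin N → Ω)} {x : Fin N → Ω}
    {p : EuclideanSpace ℝ (Fin N)} (hp : p ∈ convexHull ℝ (convUA A x)) :
    fConv A x ^ 2 ≤ ‖p‖ ^ 2 := by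
  have h : fConv A x ≤ ‖p‖ := by
    simpa [fConv] using Metric.infDist_le_dist_of_mem (x := 0) hp
  exact pow_le_pow_left₀ Metric.infDist_nonneg h 2

lemma norm_consAffine_sq {N : ℕ} (c : ℝ) (p : EuclideanSpace ℝ (Fin N)) :
    ‖consAffine c p‖ ^ 2 = c ^ 2 + ‖p‖ ^ 2 := by
  simp [EuclideanSpace.norm_sq_eq, Fin.sum_univ_succ]

lemma fConv_cons_sq_le_self {N : ℕ} {Ω : Type*} {A : Set (Fin (N + 1) → Ω)} {ω : Ω}
    (h : (headSection A ω).Nonempty) (x : Fin N → Ω) :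
    fConv A (Fin.cons ω x) ^ 2 ≤ fConv (headSection A ω) x ^ 2 := by
  obtain ⟨p, hp, hn⟩ := exists_norm_eq_fConv h x
  have := fConv_sq_le (consAffine_mem_convexHull (.inl ⟨rfl, rfl⟩) hp)
  rwa [norm_consAffine_sq, hn, zero_pow two_ne_zero, zero_add] at this

lemma fConv_cons_sq_le_other {N : ℕ} {Ω : Type*} {A : Set (Fin (N + 1) → Ω)} {ω' : Ω}
    (h : (headSection A ω').Nonempty) (ω : Ω) (x : Fin N → Ω) :
    fConv A (Fin.cons ω x) ^ 2 ≤ 1 + fConv (headSection A ω') x ^ 2 := by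
  obtain ⟨p, hp, hn⟩ := exists_norm_eq_fConv h x
  have := fConv_sq_le (consAffine_mem_convexHull (ω := ω) (.inr rfl) hp)
  rwa [norm_consAffine_sq, hn, one_pow] at this

lemma fConv_cons_sq_le_mix {N : ℕ} {Ω : Type*} {A : Set (Fin (N + 1) → Ω)} {ω ω' : Ω}
    (h : (headSection A ω).Nonempty) (h' : (headSection A ω').Nonempty) (x : Fin N → Ω)
    {t : ℝ} (ht0 : 0 ≤ t) (ht1 : t ≤ 1) :
    fConv A (Fin.cons ω x) ^ 2 ≤
      t ^ 2 + (1 - t) * fConv (headSection A ω) x ^ 2 + t * fConv (headSection A ω') x ^ 2 := by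
  obtain ⟨p, hp, hpn⟩ := exists_norm_eq_fConv h x
  obtain ⟨q, hq, hqn⟩ := exists_norm_eq_fConv h' x
  have hmem := convex_convexHull ℝ _ (consAffine_mem_convexHull (.inl ⟨rfl, rfl⟩) hp)
    (consAffine_mem_convexHull (ω := ω) (.inr rfl) hq) (sub_nonneg.2 ht1) ht0 (by ring)
  have hcomb : (1 - t) • consAffine 0 p + t • consAffine 1 q =
      consAffine t ((1 - t) • p + t • q) := by
    ext i; refine Fin.cases ?_ (fun j => ?_) i <;> simp
  rw [hcomb] at hmem
  have hle := fConv_sq_le hmem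
  rw [norm_consAffine_sq] at hle
  have hnorm : ‖(1 - t) • p + t • q‖ ≤ (1 - t) * ‖p‖ + t * ‖q‖ := by
    refine (norm_add_le _ _).trans_eq ?_
    rw [norm_smul, norm_smul, Real.norm_of_nonneg ht0, Real.norm_of_nonneg (sub_nonneg.2 ht1)]
  have hsq := pow_le_pow_left₀ (norm_nonneg _) hnorm 2
  rw [← hpn, ← hqn]
  nlinarith [mul_nonneg (mul_nonneg ht0 (sub_nonneg.2 ht1)) (sq_nonneg (‖p‖ - ‖q‖))]

lemma one_add_exp_le_two_mul_rpow {α L : ℝ} (hα : 0 < α) (hL0 : 0 ≤ L)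
    (hL : (α + 1) * L ≤ 2) :
    1 + Real.exp (α * L - α * (α + 1) * L ^ 2 / 4) ≤
      2 * ((1 + Real.exp (-L)) / 2) ^ (-α) := by
  have hcosh (u : ℝ) : 1 + Real.exp u = 2 * (Real.exp (u / 2) * Real.cosh (u / 2)) := by
    rw [Real.cosh_eq, mul_div_assoc', mul_div_cancel₀ _ two_ne_zero, mul_add, ← Real.exp_add,
      ← Real.exp_add, add_halves, add_neg_cancel, Real.exp_zero, add_comm]
  have hle (u : ℝ) : 1 + Real.exp u ≤ 2 * Real.exp (u / 2 + u ^ 2 / 8) := by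
    rw [hcosh, Real.exp_add]
    gcongr
    exact (Real.cosh_le_exp_half_sq _).trans_eq (by ring_nf)
  set w := α * L - α * (α + 1) * L ^ 2 / 4 with hw
  have hαL : 0 ≤ α * L := by positivity
  have hw0 : 0 ≤ w := by nlinarith
  have hw1 : w ≤ α * L := by
    have : 0 ≤ α * (α + 1) * L ^ 2 / 4 := by positivity
    linarith
  have hw2 : w ^ 2 ≤ (α * L) ^ 2 := pow_le_pow_left₀ hw0 hw1 2
  refine (hle w).trans ?_
  gcongr
  have hbase : (1 + Real.exp (-L)) / 2 ≤ Real.exp (-L / 2 + L ^ 2 / 8) := by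
    have := hle (-L)
    rw [neg_sq] at this
    linarith
  refine le_trans ?_ (Real.rpow_le_rpow_of_nonpos (by positivity) hbase (by linarith))
  rw [← Real.exp_mul, Real.exp_le_exp]
  nlinarith

lemma exists_weight {α a b : ℝ} (hα : 0 < α) (ha : 0 ≤ a) (hab : a ≤ b) (hb : 0 < b) :
    ∃ t : ℝ, 0 ≤ t ∧ t ≤ 1 ∧ (a = 0 → t = 1) ∧
      b ^ (-α) + Real.exp (α / (α + 1) * t ^ 2) * ((a ^ (-α)) ^ (1 - t) * (b ^ (-α)) ^ t) ≤
        2 * ((a + b) / 2) ^ (-α) := by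
  have hα1 : 0 < α + 1 := by linarith
  by_cases hr : a ≤ b * Real.exp (-(2 / (α + 1)))
  · refine ⟨1, zero_le_one, le_rfl, fun _ => rfl, ?_⟩
    have hcore := one_add_exp_le_two_mul_rpow (L := 2 / (α + 1)) hα (by positivity)
      (mul_div_cancel₀ _ hα1.ne').le
    have hexp : α * (2 / (α + 1)) - α * (α + 1) * (2 / (α + 1)) ^ 2 / 4 = α / (α + 1) := by
      field_simp
      ring
    rw [hexp] at hcore
    have hmono : (b * ((1 + Real.exp (-(2 / (α + 1)))) / 2)) ^ (-α) ≤ ((a + b) / 2) ^ (-α) :=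
      Real.rpow_le_rpow_of_nonpos (by positivity) (by linarith) (by linarith)
    rw [Real.mul_rpow hb.le (by positivity)] at hmono
    have hbα : 0 < b ^ (-α) := by positivity
    have := mul_le_mul_of_nonneg_left hcore hbα.le
    simp only [sub_self, Real.rpow_zero, Real.rpow_one, one_pow, mul_one, one_mul]
    linarith
  · push Not at hr
    have ha0 : 0 < a := lt_trans (by positivity) hr
    set L := Real.log b - Real.log a with hLdef
    have hL0 : 0 ≤ L := sub_nonneg.2 (Real.log_le_log ha0 hab)
    have hL : (α + 1) * L ≤ 2 := by
      have := Real.log_lt_log (by positivity) hr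
      rw [Real.log_mul hb.ne' (by positivity), Real.log_exp] at this
      rw [← le_div_iff₀' hα1]
      linarith
    refine ⟨(α + 1) * L / 2, by positivity, by linarith, fun h => absurd h ha0.ne', ?_⟩
    have hcore := one_add_exp_le_two_mul_rpow hα hL0 hL
    have hbα : 0 < b ^ (-α) := by positivity
    have hab' : (a + b) / 2 = b * ((1 + Real.exp (-L)) / 2) := by
      rw [hLdef, neg_sub, Real.exp_sub, Real.exp_log ha0, Real.exp_log hb]
      field_simp
      ring
    have hmix : Real.exp (α / (α + 1) * ((α + 1) * L / 2) ^ 2) *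
        ((a ^ (-α)) ^ (1 - (α + 1) * L / 2) * (b ^ (-α)) ^ ((α + 1) * L / 2)) =
        b ^ (-α) * Real.exp (α * L - α * (α + 1) * L ^ 2 / 4) := by
      have hloga : Real.log a = Real.log b - L := by rw [hLdef]; ring
      rw [Real.rpow_def_of_pos ha0, Real.rpow_def_of_pos hb, ← Real.exp_mul, ← Real.exp_mul,
        ← Real.exp_add, ← Real.exp_add, ← Real.exp_add, hloga]
      congr 1
      field_simp
      ring
    rw [hmix, hab', Real.mul_rpow hb.le (by positivity)]
    have := mul_le_mul_of_nonneg_left hcore hbα.le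
    linarith

/-- The uniform average of a function on the discrete cube. -/
noncomputable def cubeAvg {N : ℕ} (g : (Fin N → Bool) → ℝ) : ℝ := (∑ x, g x) / 2 ^ N

/-- The uniform density of a subset of the discrete cube. -/
noncomputable def cubeDensity {N : ℕ} (A : Set (Fin N → Bool)) : ℝ := cubeAvg (A.indicator 1)

lemma cubeAvg_mono {N : ℕ} {g h : (Fin N → Bool) → ℝ} (hgh : ∀ x, g x ≤ h x) :
    cubeAvg g ≤ cubeAvg h := by
  unfold cubeAvg
  gcongr
  exact hgh _

lemma cubeAvg_const_mul {N : ℕ} (c : ℝ) (g : (Fin N → Bool) → ℝ) :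
    cubeAvg (fun x => c * g x) = c * cubeAvg g := by
  simp only [cubeAvg, ← Finset.mul_sum, mul_div_assoc]

lemma cubeAvg_add {N : ℕ} (g h : (Fin N → Bool) → ℝ) :
    cubeAvg (fun x => g x + h x) = cubeAvg g + cubeAvg h := by
  simp only [cubeAvg, Finset.sum_add_distrib, add_div]

lemma cubeAvg_succ {N : ℕ} (g : (Fin (N + 1) → Bool) → ℝ) (ω : Bool) :
    cubeAvg g =
      (cubeAvg (fun x => g (Fin.cons ω x)) + cubeAvg (fun x => g (Fin.cons (!ω) x))) / 2 := by
  have hsum : ∑ x, g x = ∑ x : Fin N → Bool, g (Fin.cons ω x) +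
      ∑ x : Fin N → Bool, g (Fin.cons (!ω) x) := by
    rw [← (Fin.consEquiv fun _ => Bool).sum_comp, Fintype.sum_prod_type, Fintype.sum_bool]
    cases ω
    · exact add_comm _ _
    · rfl
  rw [cubeAvg, cubeAvg, cubeAvg, hsum, pow_succ]
  field_simp

lemma cubeDensity_succ {N : ℕ} (A : Set (Fin (N + 1) → Bool)) (ω : Bool) :
    cubeDensity A = (cubeDensity (headSection A ω) + cubeDensity (headSection A !ω)) / 2 :=
  cubeAvg_succ _ ω

lemma cubeDensity_nonneg {N : ℕ} (A : Set (Fin N → Bool)) : 0 ≤ cubeDensity A :=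
  div_nonneg (Finset.sum_nonneg fun _ _ => Set.indicator_nonneg (fun _ _ => zero_le_one) _)
    (by positivity)

lemma cubeDensity_pos_iff {N : ℕ} {A : Set (Fin N → Bool)} :
    0 < cubeDensity A ↔ A.Nonempty := by
  constructor
  · intro h
    by_contra hA
    rw [Set.not_nonempty_iff_eq_empty] at hA
    simp [hA, cubeDensity, cubeAvg] at h
  · rintro ⟨y, hy⟩
    refine div_pos (Finset.sum_pos' (fun _ _ => Set.indicator_nonneg (fun _ _ => zero_le_one) _)
      ⟨y, Finset.mem_univ _, ?_⟩) (by positivity)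
    simp [hy]

/-- Weighted Hölder inequality for exponentials, given bounds on the two factors. -/
lemma cubeAvg_exp_convex_le {N : ℕ} {u v : (Fin N → Bool) → ℝ} {C D t : ℝ} (hC : 0 < C)
    (hD : 0 < D) (ht0 : 0 ≤ t) (ht1 : t ≤ 1) (hu : cubeAvg (fun x => Real.exp (u x)) ≤ C)
    (hv : cubeAvg (fun x => Real.exp (v x)) ≤ D) :
    cubeAvg (fun x => Real.exp ((1 - t) * u x + t * v x)) ≤ C ^ (1 - t) * D ^ t := by
  have hpt (x : Fin N → Bool) : Real.exp ((1 - t) * u x + t * v x) ≤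
      C ^ (1 - t) * D ^ t * ((1 - t) / C * Real.exp (u x) + t / D * Real.exp (v x)) := by
    have h := Real.geom_mean_le_arith_mean2_weighted (sub_nonneg.2 ht1) ht0
      (p₁ := Real.exp (u x) / C) (p₂ := Real.exp (v x) / D) (by positivity) (by positivity)
      (by ring)
    rw [Real.div_rpow (by positivity) hC.le, Real.div_rpow (by positivity) hD.le,
      ← Real.exp_mul, ← Real.exp_mul, div_mul_div_comm, ← Real.exp_add,
      div_le_iff₀ (by positivity)] at h
    calc _ = Real.exp (u x * (1 - t) + v x * t) := by ring_nf
      _ ≤ _ := h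
      _ = _ := by ring
  refine (cubeAvg_mono hpt).trans ?_
  rw [cubeAvg_const_mul, cubeAvg_add, cubeAvg_const_mul, cubeAvg_const_mul]
  refine mul_le_of_le_one_right (by positivity) ?_
  have h1 : (1 - t) / C * cubeAvg (fun x => Real.exp (u x)) ≤ (1 - t) / C * C :=
    mul_le_mul_of_nonneg_left hu (div_nonneg (sub_nonneg.2 ht1) hC.le)
  have h2 : t / D * cubeAvg (fun x => Real.exp (v x)) ≤ t / D * D :=
    mul_le_mul_of_nonneg_left hv (by positivity)
  rw [div_mul_cancel₀ _ hC.ne'] at h1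
  rw [div_mul_cancel₀ _ hD.ne'] at h2
  linarith

theorem cubeAvg_exp_fConv_sq_le {α : ℝ} (hα : 0 < α) {N : ℕ} {A : Set (Fin N → Bool)}
    (hA : A.Nonempty) :
    cubeAvg (fun x => Real.exp (α / (α + 1) * fConv A x ^ 2)) ≤ cubeDensity A ^ (-α) := by
  induction N with
  | zero =>
    have hf (x : Fin 0 → Bool) : fConv A x = 0 := by
      obtain ⟨p, -, hp⟩ := exists_norm_eq_fConv hA x
      rw [← hp, Subsingleton.elim p 0, norm_zero]
    obtain rfl : A = Set.univ := Subsingleton.eq_univ_of_nonempty hA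
    simp [hf, cubeAvg, cubeDensity]
  | succ N ih =>
    have hα1 : 0 < α + 1 := by linarith
    have hK : 0 ≤ α / (α + 1) := by positivity
    obtain ⟨ω, hω⟩ : ∃ ω, cubeDensity (headSection A ω) ≤ cubeDensity (headSection A !ω) := by
      rcases le_total (cubeDensity (headSection A true)) (cubeDensity (headSection A false))
        with h | h
      · exact ⟨true, h⟩
      · exact ⟨false, h⟩
    have hdens := cubeDensity_succ A ω
    have hb : 0 < cubeDensity (headSection A !ω) := by
      have := cubeDensity_pos_iff.2 hA
      linarith
    have hne' := cubeDensity_pos_iff.1 hb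
    obtain ⟨t, ht0, ht1, hta, ht⟩ := exists_weight hα (cubeDensity_nonneg _) hω hb
    have hbig : cubeAvg (fun x => Real.exp (α / (α + 1) * fConv A (Fin.cons (!ω) x) ^ 2)) ≤
        cubeDensity (headSection A !ω) ^ (-α) := by
      refine (cubeAvg_mono fun x => ?_).trans (ih hne')
      gcongr Real.exp (_ * ?_)
      exact fConv_cons_sq_le_self hne' x
    have hsmall : cubeAvg (fun x => Real.exp (α / (α + 1) * fConv A (Fin.cons ω x) ^ 2)) ≤
        Real.exp (α / (α + 1) * t ^ 2) * ((cubeDensity (headSection A ω) ^ (-α)) ^ (1 - t) *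
          (cubeDensity (headSection A !ω) ^ (-α)) ^ t) := by
      rcases (cubeDensity_nonneg (headSection A ω)).eq_or_lt with ha | ha
      · rw [hta ha.symm]
        simp only [sub_self, Real.rpow_zero, Real.rpow_one, one_pow, mul_one, one_mul]
        refine le_trans (cubeAvg_mono fun x => ?_)
          ((cubeAvg_const_mul _ _).trans_le (mul_le_mul_of_nonneg_left (ih hne') (by positivity)))
        rw [← Real.exp_add, Real.exp_le_exp]
        have := mul_le_mul_of_nonneg_left (fConv_cons_sq_le_other hne' ω x) hK
        linarith
      · have hne := cubeDensity_pos_iff.1 ha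
        refine le_trans (cubeAvg_mono fun x => ?_)
          ((cubeAvg_const_mul _ _).trans_le (mul_le_mul_of_nonneg_left
            (cubeAvg_exp_convex_le (by positivity) (by positivity) ht0 ht1 (ih hne) (ih hne'))
            (by positivity)))
        rw [← Real.exp_add, Real.exp_le_exp]
        have := mul_le_mul_of_nonneg_left (fConv_cons_sq_le_mix hne hne' x ht0 ht1) hK
        linarith
    rw [cubeAvg_succ _ ω, hdens]
    linarith

lemma lintegral_piP_eq_ofReal_cubeAvg {N : ℕ} {μ : Measure Bool} [IsProbabilityMeasure μ]
    (hμ : μ {true} = 2⁻¹) {g : (Fin N → Bool) → ℝ} (hg : ∀ x, 0 ≤ g x) :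
    ∫⁻ x, ENNReal.ofReal (g x) ∂(piP μ N) = ENNReal.ofReal (cubeAvg g) := by
  have hfalse : μ {false} = 2⁻¹ := by
    have h := prob_compl_eq_one_sub (μ := μ) (measurableSet_singleton true)
    rw [hμ, ENNReal.one_sub_inv_two] at h
    rw [← h]
    congr 1
    ext b
    simp
  have hsingle (x : Fin N → Bool) : piP μ N {x} = ENNReal.ofReal ((2 ^ N)⁻¹) := by
    have hb (b : Bool) : μ {b} = 2⁻¹ := by cases b <;> assumption
    rw [piP, Measure.pi_singleton]
    simp [hb, ENNReal.ofReal_inv_of_pos, ENNReal.ofReal_pow, ENNReal.inv_pow]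
  rw [lintegral_fintype, cubeAvg, div_eq_mul_inv, Finset.sum_mul,
    ENNReal.ofReal_sum_of_nonneg fun x _ => mul_nonneg (hg x) (by positivity)]
  refine Finset.sum_congr rfl fun x _ => ?_
  rw [hsingle, ENNReal.ofReal_mul (hg x)]

lemma piP_eq_ofReal_cubeDensity {N : ℕ} {μ : Measure Bool} [IsProbabilityMeasure μ]
    (hμ : μ {true} = 2⁻¹) (A : Set (Fin N → Bool)) :
    piP μ N A = ENNReal.ofReal (cubeDensity A) := by
  rw [cubeDensity, ← lintegral_piP_eq_ofReal_cubeAvg hμ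
    (g := A.indicator 1) fun x => Set.indicator_nonneg (fun _ _ => zero_le_one) x,
    ← lintegral_indicator_one A.toFinite.measurableSet]
  refine lintegral_congr fun x => ?_
  by_cases hx : x ∈ A <;> simp [hx]

/-- Theorem 4.3.1 of Talagrand: on the two-point space `Ω = {0,1}` (realized as `Bool`)
with the uniform probability `μ`, for every `α ≥ 1` and every `A ⊆ Ω^N` of positive
probability, `∫ exp((α/(α+1)) f_c(A,x)²) dP(x) ≤ P(A)^{-α}`. -/
theorem talagrand_stmt17 (N : ℕ) (hN : 1 ≤ N)
    (μ : Measure Bool) [IsProbabilityMeasure μ] (hμ : μ {true} = 2⁻¹)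
    (A : Set (Fin N → Bool)) (hA0 : 0 < piP μ N A)
    (α : ℝ) (hα : 1 ≤ α) :
    ∫⁻ x, ENNReal.ofReal (Real.exp (α / (α + 1) * fConv A x ^ 2)) ∂(piP μ N) ≤
      (piP μ N A ^ α)⁻¹ := by
  have hαpos : 0 < α := by linarith
  rw [piP_eq_ofReal_cubeDensity hμ] at hA0 ⊢
  have hd : 0 < cubeDensity A := ENNReal.ofReal_pos.1 hA0
  rw [lintegral_piP_eq_ofReal_cubeAvg hμ fun x => (Real.exp_pos _).le,
    ENNReal.ofReal_rpow_of_pos hd, ← ENNReal.ofReal_inv_of_pos (by positivity),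
    ← Real.rpow_neg hd.le]
  exact ENNReal.ofReal_le_ofReal (cubeAvg_exp_fConv_sq_le hαpos (cubeDensity_pos_iff.1 hd))
end
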